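/- Let Z₁, Z₂ be independent standard Gaussian random variables, let A be a real 2×2 matrix, and set (Y, X) := A·(Z₁, Z₂), so that (Y, X) is a centered jointly Gaussian vector. Then Cov(Y², X²) = E[Y²X²] − E[Y²]E[X²] = 2·(E[YX])². -/

import Mathlib

open MeasureTheory ProbabilityTheory

theorem iteratedDeriv_four_exp_sq_div_two_zero :
    iteratedDeriv 4 (fun t : ℝ => Real.exp (t ^ 2 / 2)) 0 = 3 := by
  have hexp (t : ℝ) :
      HasDerivAt (fun s : ℝ => Real.exp (s ^ 2 / 2)) (Real.exp (t ^ 2 / 2) * t) t := by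
    convert ((hasDerivAt_pow 2 t).div_const 2).exp using 1
    simp
  have hone : deriv (fun t : ℝ => Real.exp (t ^ 2 / 2)) =
      fun t => Real.exp (t ^ 2 / 2) * t :=
    funext fun t => (hexp t).deriv
  have htwo : deriv (fun t : ℝ => Real.exp (t ^ 2 / 2) * t) =
      fun t => Real.exp (t ^ 2 / 2) * (t ^ 2 + 1) := by
    funext t
    rw [((hexp t).fun_mul (hasDerivAt_id' t)).deriv]
    ring
  have hthree : deriv (fun t : ℝ => Real.exp (t ^ 2 / 2) * (t ^ 2 + 1)) =
      fun t => Real.exp (t ^ 2 / 2) * (t ^ 3 + 3 * t) := by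
    funext t
    rw [((hexp t).fun_mul ((hasDerivAt_pow 2 t).add_const 1)).deriv]
    push_cast
    ring
  have hfour : deriv (fun t : ℝ => Real.exp (t ^ 2 / 2) * (t ^ 3 + 3 * t)) 0 = 3 := by
    rw [((hexp 0).fun_mul ((hasDerivAt_pow 3 0).fun_add
      ((hasDerivAt_id' (0 : ℝ)).const_mul 3))).deriv]
    norm_num
  simp only [iteratedDeriv_succ, iteratedDeriv_zero, hone, htwo, hthree, hfour]

theorem integral_sq_gaussianReal_zero_one : ∫ x, x ^ 2 ∂gaussianReal 0 1 = 1 := by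
  have h := variance_fun_id_gaussianReal (μ := 0) (v := 1)
  rw [variance_of_integral_eq_zero (by fun_prop) integral_id_gaussianReal] at h
  simpa using h

theorem integral_pow_four_gaussianReal_zero_one : ∫ x, x ^ 4 ∂gaussianReal 0 1 = 3 := by
  have h := iteratedDeriv_mgf_zero (X := id) (μ := gaussianReal 0 1) (by simp) 4
  rw [mgf_id_gaussianReal] at h
  simpa [iteratedDeriv_four_exp_sq_div_two_zero] using h.symm

theorem integrable_pow_gaussianReal (m : ℝ) (v : NNReal) (n : ℕ) :
    Integrable (fun x => x ^ n) (gaussianReal m v) := by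
  have h : MemLp id n (gaussianReal m v) := memLp_id_gaussianReal' n (by simp)
  refine (integrable_norm_iff (by fun_prop)).1 ?_
  simpa using h.integrable_norm_pow'

/-- Isserlis' theorem for squares of a centered bivariate Gaussian vector
`(Y, X) = A·(Z₁, Z₂)`: `Cov(Y², X²) = 2·(E[YX])²`. -/
theorem isserlis_squares {Ω : Type*} [MeasurableSpace Ω] (P : Measure Ω)
    [IsProbabilityMeasure P] (Z₁ Z₂ : Ω → ℝ)
    (hZ₁ : Measurable Z₁) (hZ₂ : Measurable Z₂)
    (hZ₁law : P.map Z₁ = gaussianReal 0 1) (hZ₂law : P.map Z₂ = gaussianReal 0 1)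
    (hindep : IndepFun Z₁ Z₂ P) (A : Matrix (Fin 2) (Fin 2) ℝ)
    (Y X : Ω → ℝ)
    (hY : Y = fun ω => A 0 0 * Z₁ ω + A 0 1 * Z₂ ω)
    (hX : X = fun ω => A 1 0 * Z₁ ω + A 1 1 * Z₂ ω) :
    (∫ ω, (Y ω) ^ 2 * (X ω) ^ 2 ∂P) - (∫ ω, (Y ω) ^ 2 ∂P) * (∫ ω, (X ω) ^ 2 ∂P)
      = 2 * (∫ ω, Y ω * X ω ∂P) ^ 2 := by
  have integral_pow {Z : Ω → ℝ} (hZ : Measurable Z) (hlaw : P.map Z = gaussianReal 0 1)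
      (n : ℕ) : ∫ ω, Z ω ^ n ∂P = ∫ x, x ^ n ∂gaussianReal 0 1 := by
    rw [← hlaw, integral_map hZ.aemeasurable (by fun_prop)]
  have integrable_pow {Z : Ω → ℝ} (hZ : Measurable Z) (hlaw : P.map Z = gaussianReal 0 1)
      (n : ℕ) : Integrable (fun ω => Z ω ^ n) P := by
    have h := integrable_pow_gaussianReal 0 1 n
    rw [← hlaw] at h
    exact h.comp_measurable hZ
  have indep_pow (i j : ℕ) : IndepFun (fun ω => Z₁ ω ^ i) (fun ω => Z₂ ω ^ j) P :=
    hindep.comp (measurable_id.pow_const i) (measurable_id.pow_const j)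
  have integrable_monomial (i j : ℕ) : Integrable (fun ω => Z₁ ω ^ i * Z₂ ω ^ j) P :=
    (indep_pow i j).integrable_mul (integrable_pow hZ₁ hZ₁law i) (integrable_pow hZ₂ hZ₂law j)
  have integral_monomial (i j : ℕ) : ∫ ω, Z₁ ω ^ i * Z₂ ω ^ j ∂P =
      (∫ x, x ^ i ∂gaussianReal 0 1) * ∫ x, x ^ j ∂gaussianReal 0 1 := by
    rw [(indep_pow i j).integral_fun_mul_eq_mul_integral
      (by fun_prop) (by fun_prop), integral_pow hZ₁ hZ₁law, integral_pow hZ₂ hZ₂law]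
  have integral_quadratic (a b c : ℝ) :
      ∫ ω, (a * (Z₁ ω ^ 2 * Z₂ ω ^ 0) + b * (Z₁ ω ^ 1 * Z₂ ω ^ 1)
        + c * (Z₁ ω ^ 0 * Z₂ ω ^ 2)) ∂P = a + c := by
    have h (i j : ℕ) (r : ℝ) := (integrable_monomial i j).const_mul r
    rw [integral_add ((h _ _ _).fun_add (h _ _ _)) (h _ _ _),
      integral_add (h _ _ _) (h _ _ _)]
    simp only [integral_const_mul, integral_monomial, integral_sq_gaussianReal_zero_one]
    simp
  have integral_quartic (a b c d e : ℝ) :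
      ∫ ω, (a * (Z₁ ω ^ 4 * Z₂ ω ^ 0) + b * (Z₁ ω ^ 3 * Z₂ ω ^ 1)
        + c * (Z₁ ω ^ 2 * Z₂ ω ^ 2) + d * (Z₁ ω ^ 1 * Z₂ ω ^ 3)
        + e * (Z₁ ω ^ 0 * Z₂ ω ^ 4)) ∂P = 3 * a + c + 3 * e := by
    have h (i j : ℕ) (r : ℝ) := (integrable_monomial i j).const_mul r
    rw [integral_add ((((h _ _ _).fun_add (h _ _ _)).fun_add (h _ _ _)).fun_add (h _ _ _)) (h _ _ _),
      integral_add (((h _ _ _).fun_add (h _ _ _)).fun_add (h _ _ _)) (h _ _ _),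
      integral_add ((h _ _ _).fun_add (h _ _ _)) (h _ _ _),
      integral_add (h _ _ _) (h _ _ _)]
    simp only [integral_const_mul, integral_monomial, integral_sq_gaussianReal_zero_one,
      integral_pow_four_gaussianReal_zero_one]
    simp
    ring
  have integral_mul_linear (a b c d : ℝ) :
      ∫ ω, (a * Z₁ ω + b * Z₂ ω) * (c * Z₁ ω + d * Z₂ ω) ∂P = a * c + b * d := by
    rw [← integral_quadratic (a * c) (a * d + b * c) (b * d)]
    congr with ω
    ring
  have integral_sq_mul_sq (a b c d : ℝ) :
      ∫ ω, (a * Z₁ ω + b * Z₂ ω) ^ 2 * (c * Z₁ ω + d * Z₂ ω) ^ 2 ∂P =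
        3 * (a ^ 2 * c ^ 2) + (a ^ 2 * d ^ 2 + 4 * a * b * c * d + b ^ 2 * c ^ 2)
          + 3 * (b ^ 2 * d ^ 2) := by
    rw [← integral_quartic (a ^ 2 * c ^ 2) (2 * a ^ 2 * c * d + 2 * a * b * c ^ 2) _
      (2 * a * b * d ^ 2 + 2 * b ^ 2 * c * d) (b ^ 2 * d ^ 2)]
    congr with ω
    ring
  subst hY hX
  rw [integral_sq_mul_sq, integral_mul_linear]
  simp only [pow_two (_ + _), integral_mul_linear]
  ring
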